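/- Let v ≥ 4 be an integer with v ≢ 2 (mod 4). Then there exists an AOA(1,3,5,v). -/

import Mathlib

/-- An orthogonal array OA(t,k,v): a `v^t × k` array with entries from `Fin v`
such that in any `t` columns every `t`-tuple appears exactly once among the rows. -/
def IsOA (t k v : ℕ) (A : Fin (v ^ t) → Fin k → Fin v) : Prop :=
  ∀ c : Fin t → Fin k, Function.Injective c →
    Function.Bijective fun r : Fin (v ^ t) => fun i : Fin t => A r (c i)

/-- An augmented orthogonal array AOA(s,t,k,v): the first `k` columns `A` form an
OA(t,k,v), the last column `L` has entries from a set of size `v^(t-s)`, and any `s`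
of the first `k` columns together with the last column contain every `(s+1)`-tuple
exactly once. -/
def IsAOA (s t k v : ℕ) (A : Fin (v ^ t) → Fin k → Fin v)
    (L : Fin (v ^ t) → Fin (v ^ (t - s))) : Prop :=
  IsOA t k v A ∧
    ∀ c : Fin s → Fin k, Function.Injective c →
      Function.Bijective fun r : Fin (v ^ t) =>
        ((fun i : Fin s => A r (c i)), L r)

/-- Existence of an AOA(s,t,k,v). -/
def ExistsAOA (s t k v : ℕ) : Prop := ∃ A L, IsAOA s t k v A L

open Function

/-- A `(G, 4; 1)`-difference matrix: any two rows have a bijective difference. -/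
def IsDifferenceMatrix {G J : Type*} [AddCommGroup G] (d : Fin 4 → J → G) : Prop :=
  ∀ k l, k ≠ l → Bijective fun j => d k j - d l j

/-- There is a four-row difference matrix over some abelian group of order `n`. -/
def ExistsDifferenceMatrix (n : ℕ) : Prop :=
  ∃ (G J : Type) (_ : AddCommGroup G) (_ : Finite G) (d : Fin 4 → J → G),
    Nat.card G = n ∧ IsDifferenceMatrix d

theorem ExistsDifferenceMatrix.mul {m n : ℕ} (hm : ExistsDifferenceMatrix m)
    (hn : ExistsDifferenceMatrix n) : ExistsDifferenceMatrix (m * n) := by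
  obtain ⟨G, J, _, _, d, rfl, hd⟩ := hm
  obtain ⟨H, K, _, _, e, rfl, he⟩ := hn
  exact ⟨G × H, J × K, inferInstance, inferInstance, fun k j => (d k j.1, e k j.2),
    Nat.card_prod G H, fun k l hkl => (hd k l hkl).prodMap (he k l hkl)⟩

theorem isDifferenceMatrix_of_injective {G J : Type*} [AddCommGroup G] [Finite G] [Finite J]
    (d : Fin 4 → J → G) (hcard : Nat.card J = Nat.card G)
    (hd : ∀ k l, k ≠ l → Injective fun j => d k j - d l j) : IsDifferenceMatrix d :=
  fun k l hkl => (Nat.bijective_iff_injective_and_card _).2 ⟨hd k l hkl, hcard⟩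

theorem existsDifferenceMatrix_of_isUnit (R : Type) [CommRing R] [Finite R] (c : Fin 4 → R)
    (hc : ∀ k l, k ≠ l → IsUnit (c k - c l)) : ExistsDifferenceMatrix (Nat.card R) := by
  refine ⟨R, R, inferInstance, inferInstance, fun k x => c k * x, rfl,
    isDifferenceMatrix_of_injective _ rfl fun k l hkl x y hxy => ?_⟩
  refine (hc k l hkl).mul_left_cancel ?_
  simpa only [sub_mul] using hxy

theorem existsDifferenceMatrix_prime_pow {p : ℕ} (hp : p.Prime) {n : ℕ} (h : 4 ≤ p ^ n) :
    ExistsDifferenceMatrix (p ^ n) := by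
  have := Fact.mk hp
  have hn : n ≠ 0 := by rintro rfl; simp at h
  have hcard := GaloisField.card p n hn
  have : Fintype (GaloisField p n) := Fintype.ofFinite _
  obtain ⟨c⟩ : Nonempty (Fin 4 ↪ GaloisField p n) := by
    rw [Function.Embedding.nonempty_iff_card_le, Fintype.card_fin, ← Nat.card_eq_fintype_card,
      hcard]
    exact h
  rw [← hcard]
  exact existsDifferenceMatrix_of_isUnit _ c fun k l hkl =>
    (sub_ne_zero.2 (c.injective.ne hkl)).isUnit

theorem isUnit_natCast_sub_natCast {m : ℕ} (hm : m.Coprime 6) (k l : Fin 4) (hkl : k ≠ l) :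
    IsUnit (((k : ℕ) : ZMod m) - ((l : ℕ) : ZMod m)) := by
  have h2 : IsUnit (2 : ZMod m) := by
    simpa using (ZMod.isUnit_iff_coprime 2 m).2 (hm.coprime_dvd_right (by norm_num)).symm
  have h3 : IsUnit (3 : ZMod m) := by
    simpa using (ZMod.isUnit_iff_coprime 3 m).2 (hm.coprime_dvd_right (by norm_num)).symm
  wlog hlt : l < k generalizing k l
  · rw [← IsUnit.neg_iff, neg_sub]
    exact this l k hkl.symm (lt_of_le_of_ne (not_lt.1 hlt) hkl)
  rw [← Nat.cast_sub hlt.le]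
  obtain h | h | h : (k - l : ℕ) = 1 ∨ (k - l : ℕ) = 2 ∨ (k - l : ℕ) = 3 := by omega
  all_goals simp [h, h2, h3]

theorem existsDifferenceMatrix_of_coprime_six {m : ℕ} (hm : m.Coprime 6) :
    ExistsDifferenceMatrix m := by
  have : NeZero m := ⟨by rintro rfl; simp at hm⟩
  simpa using existsDifferenceMatrix_of_isUnit (ZMod m) (fun k => ((k : ℕ) : ZMod m))
    (isUnit_natCast_sub_natCast hm)

/-- The second components of three columns of a difference matrix over `ZMod m × ZMod 3`,
one block of three columns for each of the twelve states. -/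
def tripleTable : Fin 12 → Fin 3 → Fin 4 → ZMod 3 :=
  ![![![0, 0, 2, 2], ![0, 0, 0, 1], ![0, 0, 1, 0]],
    ![![0, 2, 2, 2], ![0, 2, 0, 1], ![0, 2, 1, 0]],
    ![![0, 1, 2, 2], ![0, 1, 0, 1], ![0, 1, 1, 0]],
    ![![0, 1, 0, 0], ![0, 0, 0, 1], ![0, 0, 1, 2]],
    ![![0, 0, 0, 0], ![0, 0, 1, 1], ![0, 2, 1, 2]],
    ![![0, 2, 2, 2], ![0, 2, 1, 0], ![0, 1, 2, 1]],
    ![![0, 1, 2, 0], ![0, 1, 0, 2], ![0, 2, 2, 1]],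
    ![![0, 2, 1, 1], ![0, 0, 0, 0], ![0, 0, 1, 2]],
    ![![0, 1, 2, 2], ![0, 0, 0, 1], ![0, 2, 1, 0]],
    ![![0, 0, 2, 0], ![0, 0, 0, 2], ![0, 1, 2, 1]],
    ![![0, 2, 2, 2], ![0, 2, 0, 1], ![0, 2, 1, 0]],
    ![![0, 1, 2, 2], ![0, 1, 0, 1], ![0, 1, 1, 0]]]

/-- The allowed successions of states: the words `0 1 2`, `3 4 5 6` and `7 8 9 10 11` may be
concatenated arbitrarily. -/
def IsStep (a b : Fin 12) : Prop :=
  if (a : ℕ) = 2 ∨ (a : ℕ) = 6 ∨ (a : ℕ) = 11 then (b : ℕ) = 0 ∨ (b : ℕ) = 3 ∨ (b : ℕ) = 7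
  else (b : ℕ) = a + 1

instance (a b : Fin 12) : Decidable (IsStep a b) := by
  unfold IsStep; infer_instance

/-- The offset `(i - 1) * (3 - k - l)`, shifted by `2`. -/
def tripleIndex (k l : Fin 4) (i : Fin 3) : Fin 5 :=
  2 - (i.castLE (by norm_num) - 1) * (k.castSucc + l.castSucc - 3)

/-- The columns of the difference matrix that agree in the first component of the difference of
rows `k` and `l` differ in its second component. -/
def IsLocallyValid (w : Fin 5 → Fin 12) : Prop :=
  ∀ k l, k ≠ l → ∀ i j, i ≠ j →
    tripleTable (w (tripleIndex k l i)) i k - tripleTable (w (tripleIndex k l i)) i l ≠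
      tripleTable (w (tripleIndex k l j)) j k - tripleTable (w (tripleIndex k l j)) j l

instance (w : Fin 5 → Fin 12) : Decidable (IsLocallyValid w) := by
  unfold IsLocallyValid; infer_instance

theorem isLocallyValid_of_isStep : ∀ a b, IsStep a b → ∀ c, IsStep b c → ∀ d, IsStep c d →
    ∀ e, IsStep d e → IsLocallyValid ![a, b, c, d, e] := by
  decide +kernel

theorem apply_tripleIndex {m : ℕ} (s : ZMod m → Fin 12) (z : ZMod m) (k l : Fin 4) (hkl : k ≠ l)
    (i : Fin 3) :
    ![s (z - 2), s (z - 1), s z, s (z + 1), s (z + 2)] (tripleIndex k l i) =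
      s (z - (((i : ℕ) : ZMod m) - 1) * (((k : ℕ) : ZMod m) + ((l : ℕ) : ZMod m) - 3)) := by
  fin_cases k <;> fin_cases l <;> first | exact absurd rfl hkl | skip
  all_goals
    fin_cases i <;> simp [tripleIndex] <;> congr 1 <;> ring

theorem existsDifferenceMatrix_mul_three_of_isStep {m : ℕ} (hm : m.Coprime 6)
    (s : ZMod m → Fin 12) (hs : ∀ x, IsStep (s x) (s (x + 1))) :
    ExistsDifferenceMatrix (m * 3) := by
  have : NeZero m := ⟨by rintro rfl; simp at hm⟩
  refine ⟨ZMod m × ZMod 3, ZMod m × Fin 3, inferInstance, inferInstance,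
    fun k x => (((k : ℕ) : ZMod m) * x.1 +
      (((x.2 : ℕ) : ZMod m) - 1) * (((k : ℕ) : ZMod m) ^ 2 - 3 * ((k : ℕ) : ZMod m)),
      tripleTable (s x.1) x.2 k), by simp, isDifferenceMatrix_of_injective _ (by simp) ?_⟩
  rintro k l hkl ⟨x, i⟩ ⟨y, j⟩ hxy
  obtain ⟨h₁, h₂⟩ := Prod.ext_iff.1 hxy
  simp only [Prod.fst_sub, Prod.snd_sub] at h₁ h₂
  set K := ((k : ℕ) : ZMod m) with hK
  set L := ((l : ℕ) : ZMod m) with hL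
  have hz : x + (((i : ℕ) : ZMod m) - 1) * (K + L - 3) =
      y + (((j : ℕ) : ZMod m) - 1) * (K + L - 3) := by
    refine (isUnit_natCast_sub_natCast hm k l hkl).mul_left_cancel ?_
    rw [← hK, ← hL]
    linear_combination h₁
  obtain ⟨z, hzx⟩ : ∃ z, z = x + (((i : ℕ) : ZMod m) - 1) * (K + L - 3) := ⟨_, rfl⟩
  have hx : x = z - (((i : ℕ) : ZMod m) - 1) * (K + L - 3) := by linear_combination -hzx
  have hy : y = z - (((j : ℕ) : ZMod m) - 1) * (K + L - 3) := by linear_combination -hzx - hz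
  have hij : i = j := by
    by_contra hij
    refine isLocallyValid_of_isStep (s (z - 2)) (s (z - 1)) ?_ (s z) ?_ (s (z + 1)) (hs z)
      (s (z + 2)) ?_ k l hkl i j hij ?_
    · convert hs (z - 2) using 2; ring
    · convert hs (z - 1) using 2; ring
    · convert hs (z + 1) using 2; ring
    · rw [apply_tripleIndex s z k l hkl, apply_tripleIndex s z k l hkl, ← hK, ← hL, ← hx, ← hy]
      exact h₂
  subst hij
  rw [hx, hy]

theorem exists_closed_walk {m : ℕ} [NeZero m] (hm : 5 ≤ m) (h3 : ¬ 3 ∣ m) :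
    ∃ s : ZMod m → Fin 12, ∀ x, IsStep (s x) (s (x + 1)) := by
  obtain ⟨g, hg, hg0⟩ : ∃ g : ℕ → Fin 12, (∀ i, i + 1 < m → IsStep (g i) (g (i + 1))) ∧
      IsStep (g (m - 1)) (g 0) := by
    obtain h | h : m % 3 = 1 ∨ m % 3 = 2 := by omega
    · refine ⟨fun i => ⟨if i < 4 then 3 + i else (i - 4) % 3, by split_ifs <;> omega⟩, ?_, ?_⟩
      · intro i hi
        unfold IsStep
        dsimp only
        split_ifs <;> omega
      · unfold IsStep
        dsimp only
        split_ifs <;> omega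
    · refine ⟨fun i => ⟨if i < 5 then 7 + i else (i - 5) % 3, by split_ifs <;> omega⟩, ?_, ?_⟩
      · intro i hi
        unfold IsStep
        dsimp only
        split_ifs <;> omega
      · unfold IsStep
        dsimp only
        split_ifs <;> omega
  refine ⟨fun x => g x.val, fun x => ?_⟩
  have hx : (x + 1).val = (x.val + 1) % m := by
    rw [← ZMod.val_natCast, Nat.cast_succ, ZMod.natCast_zmod_val]
  simp only [hx]
  obtain h | h := (Nat.succ_le_of_lt (ZMod.val_lt x)).lt_or_eq
  · rw [Nat.mod_eq_of_lt h]
    exact hg _ h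
  · have hm' : m - 1 = x.val := by omega
    rwa [show x.val + 1 = m from h, Nat.mod_self, ← hm']

theorem existsDifferenceMatrix_mul_three {m : ℕ} (hm : m.Coprime 6) (h5 : 5 ≤ m) :
    ExistsDifferenceMatrix (m * 3) := by
  have : NeZero m := ⟨by omega⟩
  obtain ⟨s, hs⟩ := exists_closed_walk h5 fun h =>
    absurd (Nat.dvd_gcd h (by norm_num : 3 ∣ 6)) (by rw [hm]; norm_num)
  exact existsDifferenceMatrix_mul_three_of_isStep hm s hs

theorem existsDifferenceMatrix_twelve : ExistsDifferenceMatrix 12 := by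
  refine ⟨ZMod 2 × ZMod 2 × ZMod 3, Fin 12, inferInstance, inferInstance,
    fun k j => (fun n : ℕ => ((n, (n / 2 : ℕ), (n / 4 : ℕ)) : ZMod 2 × ZMod 2 × ZMod 3))
      (![![0, 0, 0, 0, 0, 0, 0, 0, 0, 0, 0, 0],
        ![0, 1, 2, 3, 4, 5, 6, 7, 8, 9, 10, 11],
        ![10, 7, 3, 0, 1, 8, 6, 11, 4, 2, 5, 9],
        ![2, 10, 1, 7, 9, 5, 0, 8, 4, 3, 11, 6]] k j),
    by simp, isDifferenceMatrix_of_injective _ (by simp) ?_⟩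
  decide +kernel

theorem existsDifferenceMatrix_twenty_four : ExistsDifferenceMatrix 24 := by
  refine ⟨ZMod 2 × ZMod 2 × ZMod 2 × ZMod 3, Fin 24, inferInstance, inferInstance,
    fun k j => (fun n : ℕ => ((n, (n / 2 : ℕ), (n / 4 : ℕ), (n / 8 : ℕ)) :
      ZMod 2 × ZMod 2 × ZMod 2 × ZMod 3))
      (![![0, 0, 0, 0, 0, 0, 0, 0, 0, 0, 0, 0, 0, 0, 0, 0, 0, 0, 0, 0, 0, 0, 0, 0],
        ![0, 1, 2, 3, 4, 5, 6, 7, 8, 9, 10, 11, 12, 13, 14, 15, 16, 17, 18, 19, 20, 21, 22, 23],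
        ![22, 10, 4, 16, 12, 6, 8, 5, 0, 21, 3, 17, 13, 1, 23, 11, 7, 20, 18, 14, 19, 15, 9, 2],
        ![6, 19, 22, 3, 8, 11, 14, 18, 0, 12, 9, 10, 17, 4, 1, 20, 23, 21, 16, 13, 15, 2, 7, 5]]
          k j),
    by simp, isDifferenceMatrix_of_injective _ (by simp) ?_⟩
  decide +kernel

theorem existsDifferenceMatrix_two_pow {a : ℕ} (ha : a ≠ 1) : ExistsDifferenceMatrix (2 ^ a) := by
  obtain rfl | h : a = 0 ∨ 2 ≤ a := by omega
  · exact existsDifferenceMatrix_of_coprime_six (by norm_num)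
  · exact existsDifferenceMatrix_prime_pow Nat.prime_two
      (Nat.pow_le_pow_right (n := 2) (i := 2) two_pos h)

theorem existsDifferenceMatrix_two_pow_mul_three {a : ℕ} (ha : 2 ≤ a) :
    ExistsDifferenceMatrix (2 ^ a * 3) := by
  obtain ⟨b, rfl⟩ := Nat.exists_eq_add_of_le' ha
  obtain rfl | hb := eq_or_ne b 1
  · exact existsDifferenceMatrix_twenty_four
  · have := (existsDifferenceMatrix_two_pow hb).mul existsDifferenceMatrix_twelve
    rwa [pow_add, mul_assoc]

theorem existsDifferenceMatrix {v : ℕ} (hv : 4 ≤ v) (hmod : v % 4 ≠ 2) :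
    ExistsDifferenceMatrix v := by
  obtain ⟨a, n, hn, rfl⟩ := Nat.exists_eq_pow_mul_and_not_dvd (n := v) (by omega) 2 (by norm_num)
  obtain ⟨b, m, hm, rfl⟩ := Nat.exists_eq_pow_mul_and_not_dvd (n := n)
    (by rintro rfl; simp at hn) 3 (by norm_num)
  have hm2 : ¬ 2 ∣ m := fun h => hn (h.mul_left _)
  have hm6 : m.Coprime 6 := Nat.Coprime.mul_right
    ((Nat.Prime.coprime_iff_not_dvd Nat.prime_two).2 hm2).symm
    ((Nat.Prime.coprime_iff_not_dvd Nat.prime_three).2 hm).symm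
  have ha : a ≠ 1 := by
    rintro rfl
    omega
  have hM := existsDifferenceMatrix_of_coprime_six hm6
  have hA := existsDifferenceMatrix_two_pow ha
  rw [← mul_assoc]
  obtain rfl | rfl | hb : b = 0 ∨ b = 1 ∨ 2 ≤ b := by omega
  · simpa using hA.mul hM
  · obtain rfl | ha : a = 0 ∨ 2 ≤ a := by omega
    · have : 5 ≤ m := by omega
      simpa [mul_comm] using existsDifferenceMatrix_mul_three hm6 this
    · simpa using (existsDifferenceMatrix_two_pow_mul_three ha).mul hM
  · refine (hA.mul (existsDifferenceMatrix_prime_pow Nat.prime_three ?_)).mul hM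
    calc 4 ≤ 3 ^ 2 := by norm_num
      _ ≤ 3 ^ b := Nat.pow_le_pow_right (by norm_num) hb

theorem exists_ordered_triple (P : Fin 5 → Prop) (c : Fin 3 → Fin 5) (hc : Injective c)
    (h : ∀ i, P (c i)) : ∃ a b c, a < b ∧ b < c ∧ P a ∧ P b ∧ P c := by
  have key : ∀ a b c : Fin 5, a ≠ b → a ≠ c → b ≠ c → ∃ x y z, x < y ∧ y < z ∧
      (x = a ∨ x = b ∨ x = c) ∧ (y = a ∨ y = b ∨ y = c) ∧ (z = a ∨ z = b ∨ z = c) := by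
    decide +kernel
  obtain ⟨x, y, z, hxy, hyz, hx, hy, hz⟩ := key _ _ _ (hc.ne (by decide : (0 : Fin 3) ≠ 1))
    (hc.ne (by decide : (0 : Fin 3) ≠ 2)) (hc.ne (by decide : (1 : Fin 3) ≠ 2))
  have hP : ∀ w, w = c 0 ∨ w = c 1 ∨ w = c 2 → P w := by
    rintro w (rfl | rfl | rfl) <;> exact h _
  exact ⟨x, y, z, hxy, hyz, hP x hx, hP y hy, hP z hz⟩

section OrthogonalArray

variable {G J : Type*} [AddCommGroup G]

/-- The five columns of an orthogonal array of strength three obtained from a difference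
matrix. -/
def differenceMatrixArray (d : Fin 4 → J → G) (r : G × G × J) : Fin 5 → G :=
  ![r.1 + d 0 r.2.2, r.1 + d 1 r.2.2, r.2.1 - d 2 r.2.2, r.2.1 - d 3 r.2.2, r.1 + r.2.1]

theorem differenceMatrixArray_injective {d : Fin 4 → J → G} (hd : IsDifferenceMatrix d)
    (c : Fin 3 → Fin 5) (hc : Injective c) :
    Injective fun r => fun i => differenceMatrixArray d r (c i) := by
  rintro ⟨x, y, j⟩ ⟨x', y', j'⟩ h
  obtain ⟨a, b, c, hab, hbc, ha, hb, hc⟩ := exists_ordered_triple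
    (fun k => differenceMatrixArray d (x, y, j) k = differenceMatrixArray d (x', y', j') k) c hc
    (congrFun h)
  have inj : ∀ k l, k ≠ l → d k j - d l j = d k j' - d l j' → j = j' :=
    fun k l hkl h => (hd k l hkl).1 h
  have hj : j = j' := by
    fin_cases a <;> fin_cases b <;> fin_cases c <;>
      first
      | exact absurd hab (by decide)
      | exact absurd hbc (by decide)
      | skip
    all_goals simp [differenceMatrixArray] at ha hb hc
    · exact inj 0 1 (by decide) (by linear_combination (norm := abel) ha - hb)
    · exact inj 0 1 (by decide) (by linear_combination (norm := abel) ha - hb)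
    · exact inj 0 1 (by decide) (by linear_combination (norm := abel) ha - hb)
    · exact inj 3 2 (by decide) (by linear_combination (norm := abel) hb - hc)
    · exact inj 0 2 (by decide) (by linear_combination (norm := abel) ha + hb - hc)
    · exact inj 0 3 (by decide) (by linear_combination (norm := abel) ha + hb - hc)
    · exact inj 3 2 (by decide) (by linear_combination (norm := abel) hb - hc)
    · exact inj 1 2 (by decide) (by linear_combination (norm := abel) ha + hb - hc)
    · exact inj 1 3 (by decide) (by linear_combination (norm := abel) ha + hb - hc)
    · exact inj 3 2 (by decide) (by linear_combination (norm := abel) ha - hb)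
  subst hj
  fin_cases a <;> fin_cases b <;> fin_cases c <;> simp_all [differenceMatrixArray]

/-- The label of a row: rows with the same label agree in no column. -/
def differenceMatrixLabel (φ : G → G) (r : G × G × J) : G × J :=
  (r.2.1 - φ r.1, r.2.2)

theorem differenceMatrixLabel_injective (d : Fin 4 → J → G) {φ : G → G} (hφ : Injective φ)
    (hφ' : Injective fun x => x + φ x) (k : Fin 5) :
    Injective fun r => (differenceMatrixArray d r k, differenceMatrixLabel φ r) := by
  rintro ⟨x, y, j⟩ ⟨x', y', j'⟩ h
  simp only [differenceMatrixLabel, Prod.mk.injEq] at h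
  obtain ⟨h, hy, rfl⟩ := h
  have hx : x = x' := by
    fin_cases k <;> simp [differenceMatrixArray] at h
    · exact h
    · exact h
    · exact hφ (by simpa [h] using hy)
    · exact hφ (by simpa [h] using hy)
    · refine hφ' ?_
      have := congrArg₂ (· - ·) h hy
      simp only at this ⊢
      convert this using 1 <;> abel
  subst hx
  simpa using hy

theorem exists_injective_add_injective {d : Fin 4 → J → G} (hd : IsDifferenceMatrix d) :
    ∃ φ : G → G, Injective φ ∧ Injective fun x => x + φ x := by
  obtain ⟨q, hq⟩ : ∃ q : J ≃ G, ∀ j, q j = d 1 j - d 0 j :=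
    ⟨.ofBijective _ (hd 1 0 (by decide)), fun _ => rfl⟩
  refine ⟨fun x => d 2 (q.symm x) - d 1 (q.symm x),
    (hd 2 1 (by decide)).1.comp q.symm.injective, ?_⟩
  convert (hd 2 0 (by decide)).1.comp q.symm.injective using 2 with x
  have := hq (q.symm x)
  rw [q.apply_symm_apply] at this
  simp only [comp_apply]
  nth_rewrite 1 [this]
  abel

end OrthogonalArray

theorem ExistsDifferenceMatrix.existsAOA {v : ℕ} (hv : ExistsDifferenceMatrix v) :
    ExistsAOA 1 3 5 v := by
  obtain ⟨G, J, _, _, d, rfl, hd⟩ := hv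
  obtain ⟨φ, hφ, hφ'⟩ := exists_injective_add_injective hd
  have hJ : Nat.card J = Nat.card G := Nat.card_congr (.ofBijective _ (hd 0 1 (by decide)))
  have : Finite J := .of_injective _ (hd 0 1 (by decide)).1
  obtain ⟨eG⟩ : Nonempty (G ≃ Fin (Nat.card G)) := ⟨Finite.equivFin G⟩
  obtain ⟨eR⟩ : Nonempty (Fin (Nat.card G ^ 3) ≃ G × G × J) :=
    ⟨(Finite.equivFinOfCardEq (by simp only [Nat.card_prod, hJ]; ring)).symm⟩
  obtain ⟨eL⟩ : Nonempty (G × J ≃ Fin (Nat.card G ^ (3 - 1))) :=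
    ⟨Finite.equivFinOfCardEq (by simp only [Nat.card_prod, hJ]; ring)⟩
  refine ⟨fun r k => eG (differenceMatrixArray d (eR r) k),
    fun r => eL (differenceMatrixLabel φ (eR r)), fun c hc => ?_, fun c _ => ?_⟩
  · rw [Nat.bijective_iff_injective_and_card]
    refine ⟨fun r r' h => eR.injective (differenceMatrixArray_injective hd c hc ?_), by simp⟩
    funext i
    exact eG.injective (congrFun h i)
  · rw [Nat.bijective_iff_injective_and_card]
    refine ⟨fun r r' h => eR.injective (differenceMatrixLabel_injective d hφ hφ' (c 0) ?_), ?_⟩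
    · obtain ⟨h₁, h₂⟩ := Prod.ext_iff.1 h
      exact Prod.ext (eG.injective (congrFun h₁ 0)) (eL.injective h₂)
    · simp
      ring

theorem aoa_1_3_5 (v : ℕ) (hv : 4 ≤ v) (hmod : v % 4 ≠ 2) :
    ExistsAOA 1 3 5 v := by
  exact (existsDifferenceMatrix hv hmod).existsAOA
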